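/- There exists a constant c > 0 such that for every measurable function F : ℂ² → [0,∞], ∫_{ℂ×ℝ} F(Ψ(z,t)) dλ(z,t) = c · ∫_{S³} F(ζ) · |1+ζ₂|^{−4} dσ(ζ). Equivalently, the pushforward of Lebesgue measure on ℂ×ℝ under Ψ is c·G⁴σ restricted to S³\{(0,−1)}, where G(ζ) = 1/|1+ζ₂|; consequently, for every 1 ≤ p < ∞ and every measurable f on ℂ×ℝ, the L^p(λ) norm of f equals c^{1/p} times the L^p(σ) norm of G^{4/p}·(f∘Ψ^{−1}). -/

import Mathlib

open MeasureTheory Filter Complex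
open scoped ENNReal ContDiff

noncomputable section

/-- `ℂ²` with the Euclidean norm. -/
abbrev E2 : Type := EuclideanSpace ℂ (Fin 2)

instance : MeasurableSpace E2 := borel E2
instance : BorelSpace E2 := ⟨rfl⟩

/-- The unit sphere `S³ ⊆ ℂ²`. -/
def S3 : Set E2 := Metric.sphere 0 1

/-- The surface measure `σ` on `S³`: the 3-dimensional Hausdorff measure
restricted to the sphere. -/
def sigmaS3 : Measure E2 := (μH[3]).restrict S3

/-- The south pole `p = (0, -1) ∈ S³`. -/
def pS : E2 := EuclideanSpace.single 1 (-1 : ℂ)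

/-- Wirtinger derivative `∂F/∂ζ₁ = (∂_{x₁} - i ∂_{y₁})F/2`. -/
def dz1 (F : E2 → ℂ) (ζ : E2) : ℂ :=
  (1 / 2 : ℂ) * (fderiv ℝ F ζ (EuclideanSpace.single 0 1)
    - Complex.I * fderiv ℝ F ζ (EuclideanSpace.single 0 Complex.I))

/-- Wirtinger derivative `∂F/∂ζ̄₁ = (∂_{x₁} + i ∂_{y₁})F/2`. -/
def dzbar1 (F : E2 → ℂ) (ζ : E2) : ℂ :=
  (1 / 2 : ℂ) * (fderiv ℝ F ζ (EuclideanSpace.single 0 1)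
    + Complex.I * fderiv ℝ F ζ (EuclideanSpace.single 0 Complex.I))

/-- Wirtinger derivative `∂F/∂ζ₂ = (∂_{x₂} - i ∂_{y₂})F/2`. -/
def dz2 (F : E2 → ℂ) (ζ : E2) : ℂ :=
  (1 / 2 : ℂ) * (fderiv ℝ F ζ (EuclideanSpace.single 1 1)
    - Complex.I * fderiv ℝ F ζ (EuclideanSpace.single 1 Complex.I))

/-- Wirtinger derivative `∂F/∂ζ̄₂ = (∂_{x₂} + i ∂_{y₂})F/2`. -/
def dzbar2 (F : E2 → ℂ) (ζ : E2) : ℂ :=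
  (1 / 2 : ℂ) * (fderiv ℝ F ζ (EuclideanSpace.single 1 1)
    + Complex.I * fderiv ℝ F ζ (EuclideanSpace.single 1 Complex.I))

/-- The tangential Cauchy–Riemann operator on `S³`:
`L̄F = ζ₂ ∂F/∂ζ̄₁ - ζ₁ ∂F/∂ζ̄₂`. -/
def Lbar (F : E2 → ℂ) (ζ : E2) : ℂ := ζ 1 * dzbar1 F ζ - ζ 0 * dzbar2 F ζ

/-- The conjugate tangential operator `LF = ζ̄₂ ∂F/∂ζ₁ - ζ̄₁ ∂F/∂ζ₂`. -/
def Lop (F : E2 → ℂ) (ζ : E2) : ℂ :=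
  (starRingEnd ℂ) (ζ 1) * dz1 F ζ - (starRingEnd ℂ) (ζ 0) * dz2 F ζ

/-- The formal adjoint of `L̄` with respect to `σ`:
`L̄*F = ζ̄₁ ∂F/∂ζ₂ - ζ̄₂ ∂F/∂ζ₁ = -LF`. -/
def Lstar (F : E2 → ℂ) (ζ : E2) : ℂ :=
  (starRingEnd ℂ) (ζ 0) * dz2 F ζ - (starRingEnd ℂ) (ζ 1) * dz1 F ζ

/-- Convergence `F j → g` in `L^p(σ)` on the sphere. -/
def TendstoLpS (p : ℝ≥0∞) (F : ℕ → E2 → ℂ) (g : E2 → ℂ) : Prop :=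
  Tendsto (fun j => eLpNorm (F j - g) p sigmaS3) atTop (nhds 0)

/-- The `L²(σ)` inner product `⟨f, g⟩_σ = ∫_{S³} f ⬝ conj g dσ`. -/
def innerS3 (f g : E2 → ℂ) : ℂ := ∫ ζ, f ζ * (starRingEnd ℂ) (g ζ) ∂sigmaS3

/-- The support of `u` is disjoint from some neighborhood of the pole `p`. -/
def VanishNearP (u : E2 → ℂ) : Prop := ∃ ε > (0 : ℝ), ∀ ζ : E2, dist ζ pS < ε → u ζ = 0

/-- `w(z,t) = t + i(1 + |z|²)`, a nonvanishing function on `ℂ × ℝ`. -/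
def wH (q : ℂ × ℝ) : ℂ := (q.2 : ℂ) + Complex.I * (1 + (Complex.normSq q.1 : ℂ))

/-- The inverse stereographic (Cayley) map `Ψ : ℂ × ℝ → S³ \ {p} ⊆ ℂ²`,
`Ψ(z,t) = (2iz/w, (2i - w)/w)`. -/
def Psi (q : ℂ × ℝ) : E2 :=
  (WithLp.equiv 2 (Fin 2 → ℂ)).symm
    ![2 * Complex.I * q.1 / wH q, (2 * Complex.I - wH q) / wH q]

lemma setLIntegral_circle_eq_norm (f : ℂ → ℝ≥0∞) (c : ℂ) :
    ∫⁻ φ : ℝ in Set.Ioc (-Real.pi) Real.pi, f (c * exp (φ * I)) =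
      ∫⁻ φ : ℝ in Set.Ioc (-Real.pi) Real.pi, f (‖c‖ * exp (φ * I)) := by
  set g : ℝ → ℝ≥0∞ := fun φ => f (‖c‖ * exp (φ * I)) with hg
  have hper : ∀ (k : AddSubgroup.zmultiples (2 * Real.pi)) (x : ℝ), g (k +ᵥ x) = g x := by
    rintro ⟨_, n, rfl⟩ x
    change f (‖c‖ * exp ((n • (2 * Real.pi) + x : ℝ) * I)) = f (‖c‖ * exp (x * I))
    congr 2
    rw [Complex.exp_eq_exp_iff_exists_int]
    exact ⟨n, by simp only [zsmul_eq_mul]; push_cast; ring⟩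
  have hshift : ∫⁻ φ : ℝ in Set.Ioc (-Real.pi) Real.pi, f (c * exp (φ * I)) =
      ∫⁻ φ : ℝ in Set.Ioc (-Real.pi + c.arg) (Real.pi + c.arg), g φ := by
    have hpt : ∀ φ : ℝ, f (c * exp (φ * I)) = g (φ + c.arg) := fun φ => by
      simp only [hg]
      conv_lhs => rw [← Complex.norm_mul_exp_arg_mul_I c]
      rw [mul_assoc, ← Complex.exp_add]
      congr 3
      push_cast
      ring
    simp only [hpt]
    have h := (measurePreserving_add_right (volume : Measure ℝ) c.arg).setLIntegral_comp_preimage_emb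
      (measurableEmbedding_addRight c.arg) g (Set.Ioc (-Real.pi + c.arg) (Real.pi + c.arg))
    rw [← h]
    simp
  rw [hshift]
  have h1 := isAddFundamentalDomain_Ioc Real.two_pi_pos (-Real.pi) volume
  have h2 := isAddFundamentalDomain_Ioc Real.two_pi_pos (-Real.pi + c.arg) volume
  have h := h2.setLIntegral_eq h1 g hper
  rwa [show -Real.pi + c.arg + 2 * Real.pi = Real.pi + c.arg by ring,
    show -Real.pi + 2 * Real.pi = Real.pi by ring] at h

lemma setLIntegral_Ioi_mul_comp_sq (g : ℝ → ℝ≥0∞) :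
    ∫⁻ r in Set.Ioi (0 : ℝ), ENNReal.ofReal r * g r =
      2⁻¹ * ∫⁻ s in Set.Ioi (0 : ℝ), g (√s) := by
  have himg : (fun r : ℝ => r ^ 2) '' Set.Ioi 0 = Set.Ioi 0 := by
    ext s
    constructor
    · rintro ⟨r, hr, rfl⟩
      exact pow_pos (Set.mem_Ioi.1 hr) 2
    · intro hs
      exact ⟨√s, Real.sqrt_pos.2 hs, Real.sq_sqrt (le_of_lt hs)⟩
  have h := lintegral_image_eq_lintegral_abs_deriv_mul (s := Set.Ioi (0 : ℝ))
    (f := fun r => r ^ 2) (f' := fun r => 2 * r) measurableSet_Ioi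
    (fun x _ => by simpa using (hasDerivAt_pow 2 x).hasDerivWithinAt)
    (fun x hx y hy hxy => (pow_left_inj₀ (le_of_lt hx) (le_of_lt hy) two_ne_zero).1 hxy)
    (fun s => g (√s))
  rw [himg] at h
  rw [h, ← lintegral_const_mul' _ _ (by simp)]
  refine setLIntegral_congr_fun measurableSet_Ioi fun r (hr : 0 < r) => ?_
  rw [Real.sqrt_sq hr.le, abs_of_pos (by positivity), ENNReal.ofReal_mul (by norm_num), ← mul_assoc,
    ← mul_assoc, ENNReal.ofReal_ofNat, ENNReal.inv_mul_cancel (by simp) (by simp), one_mul]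

lemma lintegral_complex_eq_circle (f : ℂ → ℝ≥0∞) (hf : Measurable f) :
    ∫⁻ z, f z = 2⁻¹ * ∫⁻ s in Set.Ioi (0 : ℝ),
      ∫⁻ φ : ℝ in Set.Ioc (-Real.pi) Real.pi, f ((√s : ℝ) * exp (φ * I)) := by
  rw [← setLIntegral_Ioi_mul_comp_sq
      (fun r => ∫⁻ φ : ℝ in Set.Ioc (-Real.pi) Real.pi, f (r * exp (φ * I))),
    ← Complex.lintegral_comp_polarCoord_symm, polarCoord_target, Measure.volume_eq_prod,
    ← Measure.prod_restrict, lintegral_prod]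
  · refine setLIntegral_congr_fun measurableSet_Ioi fun r _ => ?_
    simp only [smul_eq_mul]
    rw [lintegral_const_mul' _ _ ENNReal.ofReal_ne_top, Measure.restrict_congr_set Ioo_ae_eq_Ioc]
    simp only [Complex.polarCoord_symm_apply, Complex.exp_mul_I]
    simp
  · simp only [Complex.polarCoord_symm_apply, smul_eq_mul]
    exact Measurable.aemeasurable (by fun_prop)

/-- The integral of `f` over the circle `{(ζ₁, u) : |ζ₁|² + |u|² = 1}`, with respect to angle. -/
def circleFiber (f : ℂ × ℂ → ℝ≥0∞) (u : ℂ) : ℝ≥0∞ :=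
  ∫⁻ φ : ℝ in Set.Ioc (-Real.pi) Real.pi, f ((√(1 - ‖u‖ ^ 2) : ℝ) * exp (φ * I), u)

lemma measurable_circleFiber {f : ℂ × ℂ → ℝ≥0∞} (hf : Measurable f) :
    Measurable (circleFiber f) := by
  unfold circleFiber
  exact Measurable.lintegral_prod_right' (f := fun p : ℂ × ℝ =>
    f ((√(1 - ‖p.1‖ ^ 2) : ℝ) * exp (p.2 * I), p.1)) (by fun_prop)

lemma add_I_ne_zero_of_im_pos {w : ℂ} (hw : 0 < w.im) : w + I ≠ 0 := fun h => by
  have := congrArg Complex.im h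
  simp at this
  linarith

lemma image_cayley_upperHalfPlane :
    (fun w : ℂ => 2 * I / (w + I) - 1) '' {w | 0 < w.im} = Metric.ball 0 1 := by
  ext u
  rw [mem_ball_zero_iff, ← sq_lt_one_iff₀ (norm_nonneg _)]
  constructor
  · rintro ⟨w, hw, rfl⟩
    have hne := add_I_ne_zero_of_im_pos hw
    have hpos : 0 < ‖w + I‖ ^ 2 := by positivity
    simp only
    rw [show 2 * I / (w + I) - 1 = (I - w) / (w + I) by field_simp; ring, norm_div, div_pow,
      div_lt_one hpos, ← Complex.normSq_eq_norm_sq, ← Complex.normSq_eq_norm_sq]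
    simp only [Complex.normSq_apply, Complex.sub_re, Complex.sub_im, Complex.add_re, Complex.add_im,
      Complex.I_re, Complex.I_im]
    have : 0 < w.im := hw
    nlinarith
  · intro hu
    have hne : 1 + u ≠ 0 := fun h => by
      rw [show u = -1 by linear_combination h] at hu
      simp at hu
    refine ⟨2 * I / (1 + u) - I, ?_, ?_⟩
    · have hpos : 0 < Complex.normSq (1 + u) := Complex.normSq_pos.2 hne
      have : (2 * I / (1 + u) - I).im = (1 - ‖u‖ ^ 2) / Complex.normSq (1 + u) := by
        rw [← Complex.normSq_eq_norm_sq, eq_div_iff hpos.ne', Complex.sub_im, Complex.div_im]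
        field_simp
        simp [Complex.normSq_apply]
        ring
      rw [Set.mem_ofPred_eq, this]
      exact div_pos (by linarith) hpos
    · simp only
      field_simp
      ring

lemma setLIntegral_upperHalfPlane_cayley (K : ℂ → ℝ≥0∞) :
    ∫⁻ w in {w : ℂ | 0 < w.im}, K (2 * I / (w + I) - 1) =
      ∫⁻ u in Metric.ball (0 : ℂ) 1, 4 * (ENNReal.ofReal ‖1 + u‖ ^ 4)⁻¹ * K u := by
  have hmeas : MeasurableSet {w : ℂ | 0 < w.im} := measurableSet_lt (by fun_prop) (by fun_prop)
  have hderiv : ∀ w ∈ {w : ℂ | 0 < w.im}, HasFDerivWithinAt (fun w : ℂ => 2 * I / (w + I) - 1)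
      ((ContinuousLinearMap.toSpanSingleton ℂ (-(2 * I) / (w + I) ^ 2)).restrictScalars ℝ)
      {w | 0 < w.im} w := by
    intro w hw
    have h : HasDerivAt (fun w : ℂ => 2 * I / (w + I) - 1) (-(2 * I) / (w + I) ^ 2) w := by
      have := ((hasDerivAt_const w (2 * I)).div ((hasDerivAt_id w).add_const I)
        (add_I_ne_zero_of_im_pos hw)).sub_const 1
      simpa using this
    exact (h.hasFDerivAt.restrictScalars ℝ).hasFDerivWithinAt
  have hinj : Set.InjOn (fun w : ℂ => 2 * I / (w + I) - 1) {w | 0 < w.im} := by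
    intro w hw v hv h
    have hw' := add_I_ne_zero_of_im_pos hw
    have hv' := add_I_ne_zero_of_im_pos hv
    have h' : 2 * I / (w + I) = 2 * I / (v + I) := sub_left_inj.1 h
    rw [div_eq_div_iff hw' hv'] at h'
    have := mul_left_cancel₀ (by simp) h'
    exact (add_right_cancel this).symm
  rw [← image_cayley_upperHalfPlane,
    lintegral_image_eq_lintegral_abs_det_fderiv_mul volume hmeas hderiv hinj]
  refine setLIntegral_congr_fun hmeas fun w hw => ?_
  have hne := add_I_ne_zero_of_im_pos hw
  have hpos : 0 < ‖w + I‖ := norm_pos_iff.2 hne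
  have hdet : ((ContinuousLinearMap.toSpanSingleton ℂ
      (-(2 * I) / (w + I) ^ 2)).restrictScalars ℝ).det = 4 / ‖w + I‖ ^ 4 := by
    simp [ContinuousLinearMap.det, LinearMap.det_restrictScalars, Algebra.norm_complex_eq,
      Complex.normSq_eq_norm_sq, ← pow_mul]
    norm_num
  have hnorm : ‖1 + (2 * I / (w + I) - 1)‖ = 2 / ‖w + I‖ := by simp
  simp only [hdet, hnorm]
  rw [← ENNReal.ofReal_pow (by positivity), ← ENNReal.ofReal_inv_of_pos (by positivity), ← mul_assoc,
    show (4 : ℝ≥0∞) = ENNReal.ofReal 4 by simp, ← ENNReal.ofReal_mul (by norm_num),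
    ← ENNReal.ofReal_mul (by positivity), abs_of_pos (by positivity)]
  rw [show 4 / ‖w + I‖ ^ 4 * (4 * ((2 / ‖w + I‖) ^ 4)⁻¹) = 1 by field_simp; norm_num]
  simp

lemma lintegral_heisenberg_eq (f : ℂ × ℂ → ℝ≥0∞) (hf : Measurable f) :
    ∫⁻ q : ℂ × ℝ, f (2 * I * q.1 / (q.2 + I * (1 + (normSq q.1 : ℂ))),
      (2 * I - (q.2 + I * (1 + (normSq q.1 : ℂ)))) / (q.2 + I * (1 + (normSq q.1 : ℂ)))) =
    2⁻¹ * ∫⁻ u in Metric.ball (0 : ℂ) 1,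
      4 * (ENNReal.ofReal ‖1 + u‖ ^ 4)⁻¹ * circleFiber f u := by
  rw [← setLIntegral_upperHalfPlane_cayley,
    ← Complex.volume_preserving_equiv_real_prod.symm.setLIntegral_comp_preimage_emb
      Complex.measurableEquivRealProd.symm.measurableEmbedding]
  have hset : Complex.measurableEquivRealProd.symm ⁻¹' {w : ℂ | 0 < w.im} =
      Set.univ ×ˢ Set.Ioi 0 := by
    ext p
    simp [Complex.measurableEquivRealProd_symm_apply]
  rw [hset, Measure.volume_eq_prod ℝ ℝ, ← Measure.prod_restrict, lintegral_prod,
    Measure.volume_eq_prod, lintegral_prod_symm, Measure.restrict_univ,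
    ← lintegral_const_mul' _ _ (by simp)]
  · refine lintegral_congr fun t => ?_
    rw [lintegral_complex_eq_circle _ (by fun_prop)]
    congr 1
    refine setLIntegral_congr_fun measurableSet_Ioi fun s (hs : 0 < s) => ?_
    simp only [circleFiber, Complex.measurableEquivRealProd_symm_apply]
    have hmk : (⟨t, s⟩ : ℂ) + I = t + I * (1 + s) := by
      apply Complex.ext <;> simp [add_comm]
    rw [hmk]
    set w : ℂ := t + I * (1 + s) with hw
    have hne : w ≠ 0 := by
      rw [← hmk]
      exact add_I_ne_zero_of_im_pos hs
    have hpos : 0 < ‖w‖ := norm_pos_iff.2 hne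
    have hwsq : ‖w‖ ^ 2 = t ^ 2 + (1 + s) ^ 2 := by
      rw [← Complex.normSq_eq_norm_sq, Complex.normSq_apply]
      simp [hw]
      ring
    have hu : ‖2 * I / w - 1‖ ^ 2 = (‖w‖ ^ 2 - 4 * s) / ‖w‖ ^ 2 := by
      rw [show 2 * I / w - 1 = (2 * I - w) / w by field_simp, norm_div, div_pow]
      congr 1
      rw [hwsq, ← Complex.normSq_eq_norm_sq, Complex.normSq_apply]
      simp [hw]
      ring
    have hrad : √(1 - ‖2 * I / w - 1‖ ^ 2) = ‖(√s : ℝ) * (2 * I / w)‖ := by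
      rw [hu, ← Real.sqrt_sq (norm_nonneg ((√s : ℝ) * (2 * I / w)))]
      congr 1
      rw [norm_mul, mul_pow, Complex.norm_real, Real.norm_eq_abs, sq_abs, Real.sq_sqrt hs.le]
      simp only [norm_div, norm_mul, Complex.norm_ofNat, Complex.norm_I]
      field_simp
      ring
    rw [hrad, ← setLIntegral_circle_eq_norm (fun z => f (z, 2 * I / w - 1))]
    refine setLIntegral_congr_fun measurableSet_Ioc fun φ _ => ?_
    have hns : (normSq ((√s : ℝ) * exp (φ * I)) : ℂ) = s := by
      rw [Complex.normSq_eq_norm_sq, norm_mul, Complex.norm_exp_ofReal_mul_I, mul_one,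
        Complex.norm_real, Real.norm_eq_abs, sq_abs, Real.sq_sqrt hs.le]
    simp only [hns, ← hw]
    congr 2
    · ring
    · field_simp
  · exact Measurable.aemeasurable (by fun_prop)
  · exact (((measurable_circleFiber hf).comp
      (by fun_prop : Measurable fun w : ℂ => 2 * I / (w + I) - 1)).comp
      Complex.measurableEquivRealProd.symm.measurable).aemeasurable

lemma lintegral_complex_comp_smul (K : ℂ → ℝ≥0∞) (hK : Measurable K) {b : ℝ} (hb : 0 < b) :
    ∫⁻ x : ℂ, K ((√b)⁻¹ • x) = ENNReal.ofReal b * ∫⁻ x, K x := by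
  have hne : (√b)⁻¹ ≠ 0 := inv_ne_zero (Real.sqrt_pos.2 hb).ne'
  rw [← lintegral_map (f := K) hK (measurable_const_smul _), Measure.map_addHaar_smul _ hne,
    lintegral_smul_measure, Complex.finrank_real_complex, inv_pow, inv_inv, Real.sq_sqrt hb.le,
    abs_of_pos hb, smul_eq_mul]

lemma lintegral_Ioo_zero_one_ofReal : ∫⁻ b in Set.Ioo (0 : ℝ) 1, ENNReal.ofReal b = 2⁻¹ := by
  rw [Measure.restrict_congr_set Ioo_ae_eq_Ioc, ← ofReal_integral_eq_lintegral_ofReal,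
    ← intervalIntegral.integral_of_le zero_le_one, integral_id]
  · rw [show ((1 : ℝ) ^ 2 - 0 ^ 2) / 2 = 2⁻¹ by norm_num,
      ENNReal.ofReal_inv_of_pos (by norm_num), ENNReal.ofReal_ofNat]
  · exact (intervalIntegrable_iff_integrableOn_Ioc_of_le zero_le_one).1
      (continuous_id.intervalIntegrable 0 1)
  · exact (ae_restrict_iff' measurableSet_Ioc).2 (ae_of_all _ fun x hx => hx.1.le)

lemma lintegral_ball_normalize_eq (f : ℂ × ℂ → ℝ≥0∞) (hf : Measurable f) :
    ∫⁻ x in {x : ℂ × ℂ | ‖x.1‖ ^ 2 + ‖x.2‖ ^ 2 < 1}, f ((√(‖x.1‖ ^ 2 + ‖x.2‖ ^ 2))⁻¹ • x) =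
      4⁻¹ * ∫⁻ u in Metric.ball (0 : ℂ) 1, circleFiber f u := by
  have hC := measurable_circleFiber hf
  set K : ℂ → ℝ≥0∞ := (Metric.ball (0 : ℂ) 1).indicator (circleFiber f) with hKdef
  have hK : Measurable K := hC.indicator measurableSet_ball
  have hmeas : MeasurableSet {x : ℂ × ℂ | ‖x.1‖ ^ 2 + ‖x.2‖ ^ 2 < 1} :=
    measurableSet_lt (by fun_prop) (by fun_prop)
  set J : ℝ → ℂ → ℝ≥0∞ := fun b x => (Set.Ioo (0 : ℝ) 1).indicator (fun _ => K ((√b)⁻¹ • x)) b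
    with hJ
  have hJm : Measurable (Function.uncurry J) := by
    have : Function.uncurry J = (Set.Ioo (0 : ℝ) 1 ×ˢ Set.univ).indicator
        (fun p : ℝ × ℂ => K ((√p.1)⁻¹ • p.2)) := by
      ext ⟨b, x⟩
      simp [hJ, Function.uncurry, Set.indicator]
    rw [this]
    exact (hK.comp (by fun_prop)).indicator (measurableSet_Ioo.prod .univ)
  have hinner : ∀ x : ℂ, ∫⁻ z : ℂ, {x : ℂ × ℂ | ‖x.1‖ ^ 2 + ‖x.2‖ ^ 2 < 1}.indicator
      (fun x => f ((√(‖x.1‖ ^ 2 + ‖x.2‖ ^ 2))⁻¹ • x)) (z, x) = 2⁻¹ * ∫⁻ b, J b x := by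
    intro x
    rw [lintegral_complex_eq_circle]
    swap
    · exact ((hf.comp (by fun_prop)).indicator hmeas).comp (by fun_prop)
    congr 1
    have hJb : ∀ b ∉ Set.Ioi (‖x‖ ^ 2), J b x = 0 := by
      intro b hb
      simp only [hJ, hKdef]
      by_cases hb' : b ∈ Set.Ioo (0 : ℝ) 1
      · rw [Set.indicator_of_mem hb', Set.indicator_of_notMem]
        rw [mem_ball_zero_iff, norm_smul, norm_inv, Real.norm_of_nonneg (Real.sqrt_nonneg b),
          inv_mul_lt_one₀ (Real.sqrt_pos.2 hb'.1), Real.lt_sqrt (norm_nonneg _)]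
        exact hb
      · rw [Set.indicator_of_notMem hb']
    have h := (measurePreserving_add_right (volume : Measure ℝ)
      (‖x‖ ^ 2)).setLIntegral_comp_preimage_emb
      (measurableEmbedding_addRight _) (fun b => J b x) (Set.Ioi (‖x‖ ^ 2))
    rw [← setLIntegral_eq_of_support_subset (μ := volume) (s := Set.Ioi (‖x‖ ^ 2)), ← h]
    · rw [Set.preimage_add_const_Ioi, sub_self]
      refine setLIntegral_congr_fun measurableSet_Ioi fun s (hs : 0 < s) => ?_
      have hb : 0 < s + ‖x‖ ^ 2 := by positivity
      have hn : ∀ φ : ℝ, ‖(√s : ℝ) * exp (φ * I)‖ ^ 2 = s := fun φ => by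
        rw [norm_mul, Complex.norm_exp_ofReal_mul_I, mul_one,
          Complex.norm_real, Real.norm_eq_abs, sq_abs, Real.sq_sqrt hs.le]
      simp only [Set.indicator, Set.mem_ofPred_eq, hn, hJ, Set.mem_Ioo, hb, true_and]
      split_ifs with h1
      · have hmem : (√(s + ‖x‖ ^ 2))⁻¹ • x ∈ Metric.ball (0 : ℂ) 1 := by
          rw [mem_ball_zero_iff, norm_smul, norm_inv, Real.norm_of_nonneg (Real.sqrt_nonneg _),
            inv_mul_lt_one₀ (Real.sqrt_pos.2 hb), Real.lt_sqrt (norm_nonneg _)]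
          linarith
        rw [hKdef, Set.indicator_of_mem hmem, circleFiber]
        refine setLIntegral_congr_fun measurableSet_Ioc fun φ _ => ?_
        congr 1
        refine Prod.ext ?_ rfl
        have : √(1 - ‖(√(s + ‖x‖ ^ 2))⁻¹ • x‖ ^ 2) = (√(s + ‖x‖ ^ 2))⁻¹ * √s := by
          rw [norm_smul, norm_inv, Real.norm_of_nonneg (Real.sqrt_nonneg _), mul_pow, inv_pow,
            Real.sq_sqrt hb.le, ← Real.sqrt_inv, ← Real.sqrt_mul (by positivity)]
          congr 1
          field_simp
          ring
        rw [this]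
        simp only [Prod.smul_mk, Complex.real_smul]
        push_cast
        ring
      · simp
    · intro b hb
      by_contra hb'
      exact hb (hJb b hb')
  rw [← lintegral_indicator hmeas, Measure.volume_eq_prod, lintegral_prod_symm]
  swap
  · exact ((hf.comp (by fun_prop)).indicator hmeas).aemeasurable
  simp only [hinner]
  rw [lintegral_const_mul' _ _ (by simp), lintegral_lintegral_swap]
  swap
  · exact (hJm.comp measurable_swap).aemeasurable
  have hb : ∀ b, ∫⁻ x, J b x =
      (Set.Ioo (0 : ℝ) 1).indicator (fun b => ENNReal.ofReal b * ∫⁻ x, K x) b := by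
    intro b
    by_cases hb : b ∈ Set.Ioo (0 : ℝ) 1
    · simp only [hJ, Set.indicator_of_mem hb]
      exact lintegral_complex_comp_smul K hK hb.1
    · simp only [hJ, Set.indicator_of_notMem hb, lintegral_zero]
  simp only [hb]
  rw [lintegral_indicator measurableSet_Ioo, lintegral_mul_const _ ENNReal.measurable_ofReal,
    lintegral_Ioo_zero_one_ofReal, ← mul_assoc, hKdef, lintegral_indicator measurableSet_ball,
    ← ENNReal.mul_inv (by simp) (by simp)]
  norm_num

/-- Multiplication of `ℂ² ≅ ℍ`, with `(a, b)` standing for the quaternion `a + b j`. -/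
def quatMul : E2 →ₗ[ℝ] E2 →ₗ[ℝ] E2 :=
  LinearMap.mk₂ ℝ (fun x y => !₂[x 0 * y 0 - x 1 * (starRingEnd ℂ) (y 1),
      x 0 * y 1 + x 1 * (starRingEnd ℂ) (y 0)])
    (fun x x' y => by ext i; fin_cases i <;> simp <;> ring)
    (fun c x y => by ext i; fin_cases i <;> simp <;> ring)
    (fun x y y' => by ext i; fin_cases i <;> simp <;> ring)
    (fun c x y => by ext i; fin_cases i <;> simp <;> ring)

lemma norm_sq_E2 (x : E2) : ‖x‖ ^ 2 = ‖x 0‖ ^ 2 + ‖x 1‖ ^ 2 := by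
  simp [EuclideanSpace.norm_sq_eq]

lemma norm_quatMul (x y : E2) : ‖quatMul x y‖ = ‖x‖ * ‖y‖ := by
  rw [← sq_eq_sq₀ (norm_nonneg _) (by positivity), mul_pow]
  simp only [norm_sq_E2, ← Complex.normSq_eq_norm_sq]
  simp [quatMul, Complex.normSq_apply]
  ring

lemma continuous_quatMul : Continuous fun p : E2 × E2 => quatMul p.1 p.2 := by
  simp only [quatMul, LinearMap.mk₂_apply]
  fun_prop

lemma measurable_comp_quatMul_normalize {F : E2 → ℝ≥0∞} (hF : Measurable F) :
    Measurable fun p : E2 × E2 => F (quatMul (‖p.1‖⁻¹ • p.1) p.2) := by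
  have h : Measurable fun p : E2 × E2 => (‖p.1‖⁻¹ • p.1, p.2) := by fun_prop
  have := (hF.comp continuous_quatMul.measurable).comp h
  exact this

/-- Left multiplication by a unit quaternion. -/
def quatMulLeft (g : E2) (hg : ‖g‖ = 1) : E2 ≃ₗᵢ[ℝ] E2 :=
  LinearIsometry.toLinearIsometryEquiv ⟨quatMul g, fun y => by rw [norm_quatMul, hg, one_mul]⟩ rfl

/-- Right multiplication by a unit quaternion. -/
def quatMulRight (g : E2) (hg : ‖g‖ = 1) : E2 ≃ₗᵢ[ℝ] E2 :=
  LinearIsometry.toLinearIsometryEquiv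
    ⟨quatMul.flip g, fun y => by rw [LinearMap.flip_apply, norm_quatMul, hg, mul_one]⟩ rfl

lemma LinearIsometryEquiv.measurePreserving_addHaar (V : Measure E2) [V.IsAddHaarMeasure]
    (L : E2 ≃ₗᵢ[ℝ] E2) : MeasurePreserving L V V := by
  refine ⟨L.continuous.measurable, ?_⟩
  have : (V.map L).IsAddHaarMeasure := L.toContinuousLinearEquiv.isAddHaarMeasure_map V
  have h := Measure.isAddLeftInvariant_eq_smul (V.map L) V
  have hball := congrArg (fun μ : Measure E2 => μ (Metric.ball 0 1)) h
  rw [Measure.map_apply L.continuous.measurable measurableSet_ball, L.preimage_ball, map_zero,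
    Measure.smul_apply] at hball
  have hpos : V (Metric.ball 0 1) ≠ 0 := (Metric.measure_ball_pos V 0 one_pos).ne'
  have hfin : V (Metric.ball 0 1) ≠ ⊤ := measure_ball_lt_top.ne
  rw [ENNReal.smul_def, smul_eq_mul] at hball
  have hone : ((V.map L).addHaarScalarFactor V : ℝ≥0∞) = 1 := by
    rw [← ENNReal.mul_left_inj hpos hfin, one_mul]
    exact hball.symm
  rw [h, ENNReal.coe_eq_one.1 hone, one_smul]

lemma lintegral_sigmaS3_comp (L : E2 ≃ₗᵢ[ℝ] E2) (F : E2 → ℝ≥0∞) (hF : Measurable F) :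
    ∫⁻ y, F (L y) ∂sigmaS3 = ∫⁻ y, F y ∂sigmaS3 := by
  have h := (L.toIsometryEquiv.measurePreserving_hausdorffMeasure 3).setLIntegral_comp_preimage
    (s := S3) Metric.isClosed_sphere.measurableSet hF
  rw [sigmaS3, ← h]
  have : (L.toIsometryEquiv) ⁻¹' S3 = S3 := by
    ext x
    simp [S3]
  rw [this]
  rfl

lemma addHaar_ball_mul_lintegral_sigmaS3 (V : Measure E2) [V.IsAddHaarMeasure]
    [SFinite sigmaS3] (F : E2 → ℝ≥0∞) (hF : Measurable F) :
    V (Metric.ball 0 1) * ∫⁻ y, F y ∂sigmaS3 =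
      sigmaS3 Set.univ * ∫⁻ x in Metric.ball 0 1, F (‖x‖⁻¹ • x) ∂V := by
  have hleft : ∫⁻ x in Metric.ball 0 1, ∫⁻ y, F (quatMul (‖x‖⁻¹ • x) y) ∂sigmaS3 ∂V =
      V (Metric.ball 0 1) * ∫⁻ y, F y ∂sigmaS3 := by
    have h0 : ∀ᵐ x ∂(V.restrict (Metric.ball 0 1)), x ≠ 0 :=
      ae_restrict_of_ae (by simp [ae_iff])
    rw [lintegral_congr_ae (g := fun _ => ∫⁻ y, F y ∂sigmaS3), lintegral_const,
      Measure.restrict_apply_univ, mul_comm]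
    filter_upwards [h0] with x hx
    exact lintegral_sigmaS3_comp (quatMulLeft (‖x‖⁻¹ • x) (norm_smul_inv_norm hx)) F hF
  have hright : ∫⁻ y, ∫⁻ x in Metric.ball 0 1, F (quatMul (‖x‖⁻¹ • x) y) ∂V ∂sigmaS3 =
      sigmaS3 Set.univ * ∫⁻ x in Metric.ball 0 1, F (‖x‖⁻¹ • x) ∂V := by
    rw [mul_comm, ← lintegral_const]
    refine setLIntegral_congr_fun Metric.isClosed_sphere.measurableSet fun y hy => ?_
    have hy1 : ‖y‖ = 1 := mem_sphere_zero_iff_norm.1 hy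
    have h := (LinearIsometryEquiv.measurePreserving_addHaar V
      (quatMulRight y hy1)).setLIntegral_comp_preimage (s := Metric.ball 0 1) measurableSet_ball
      (f := fun x => F (‖x‖⁻¹ • x)) (by fun_prop)
    rw [← h, (quatMulRight y hy1).preimage_ball, map_zero]
    refine lintegral_congr fun x => ?_
    rw [LinearIsometryEquiv.norm_map, map_smul, LinearMap.smul_apply]
    rfl
  rw [← hleft, ← hright, lintegral_lintegral_swap]
  exact (measurable_comp_quatMul_normalize hF).aemeasurable

lemma hausdorffMeasure_fin_three : (μH[3] : Measure (Fin 3 → ℝ)) = volume := by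
  rw [← hausdorffMeasure_pi_real]
  norm_num

lemma sigmaS3_univ_lt_top : sigmaS3 Set.univ < ⊤ := by
  set Φ : (Fin 3 → ℝ) → E2 := fun a =>
    !₂[(Real.cos (a 0) : ℂ) * exp (a 1 * I), (Real.sin (a 0) : ℂ) * exp (a 2 * I)] with hΦ
  have hsmooth : ContDiff ℝ 1 Φ := by
    refine (contDiff_piLp (𝕜 := ℝ) 2).2 fun i => ?_
    have hcast : ContDiff ℝ 1 ((↑) : ℝ → ℂ) := Complex.ofRealCLM.contDiff
    have hexp : ∀ j : Fin 3, ContDiff ℝ 1 fun a : Fin 3 → ℝ => exp (a j * I) := fun j =>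
      ((hcast.comp (contDiff_apply ℝ ℝ j)).mul contDiff_const).cexp
    fin_cases i
    · exact (hcast.comp (Real.contDiff_cos.comp (contDiff_apply ℝ ℝ 0))).mul (hexp 1)
    · exact (hcast.comp (Real.contDiff_sin.comp (contDiff_apply ℝ ℝ 0))).mul (hexp 2)
  obtain ⟨K, hK⟩ := hsmooth.contDiffOn.exists_lipschitzOnWith one_ne_zero
    (convex_closedBall (0 : Fin 3 → ℝ) 4) (isCompact_closedBall _ _)
  have hsub : S3 ⊆ Φ '' Metric.closedBall 0 4 := by
    intro x hx
    have hsq : ‖x 0‖ ^ 2 + ‖x 1‖ ^ 2 = 1 := by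
      rw [← norm_sq_E2, mem_sphere_zero_iff_norm.1 hx, one_pow]
    have hx0 : ‖x 0‖ ≤ 1 := by nlinarith [norm_nonneg (x 0), norm_nonneg (x 1)]
    refine ⟨![Real.arccos ‖x 0‖, (x 0).arg, (x 1).arg], ?_, ?_⟩
    · rw [mem_closedBall_zero_iff, pi_norm_le_iff_of_nonneg (by norm_num)]
      have hpi := Real.pi_lt_four.le
      intro i
      fin_cases i
      · simpa [abs_of_nonneg (Real.arccos_nonneg _)] using (Real.arccos_le_pi _).trans hpi
      · exact (Complex.abs_arg_le_pi _).trans hpi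
      · exact (Complex.abs_arg_le_pi _).trans hpi
    · have hs : √(1 - ‖x 0‖ ^ 2) = ‖x 1‖ := by
        rw [← hsq, add_sub_cancel_left, Real.sqrt_sq (norm_nonneg _)]
      ext i
      fin_cases i
      · simp [hΦ, Real.cos_arccos (by linarith [norm_nonneg (x 0)]) hx0, -Complex.ofReal_cos]
      · simp [hΦ, Real.sin_arccos, hs, -Complex.ofReal_sin]
  have hvol : μH[3] (Metric.closedBall (0 : Fin 3 → ℝ) 4) < ⊤ := by
    rw [hausdorffMeasure_fin_three]
    exact measure_closedBall_lt_top
  rw [sigmaS3, Measure.restrict_apply_univ]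
  refine ((measure_mono hsub).trans (hK.hausdorffMeasure_image_le (by norm_num))).trans_lt ?_
  exact ENNReal.mul_lt_top (ENNReal.rpow_lt_top_of_nonneg (by norm_num) ENNReal.coe_ne_top) hvol

lemma sigmaS3_univ_ne_zero : sigmaS3 Set.univ ≠ 0 := by
  set P : E2 → (Fin 3 → ℝ) := fun x => ![(x 0).re, (x 0).im, (x 1).re] with hP
  have hcoord : ∀ i : Fin 2, ContDiff ℝ 1 fun x : E2 => x i := fun i =>
    (contDiff_piLp (𝕜 := ℝ) 2).1 contDiff_id i
  have hsmooth : ContDiff ℝ 1 P := by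
    refine contDiff_pi.2 fun i => ?_
    fin_cases i
    · exact Complex.reCLM.contDiff.comp (hcoord 0)
    · exact Complex.imCLM.contDiff.comp (hcoord 0)
    · exact Complex.reCLM.contDiff.comp (hcoord 1)
  obtain ⟨K, hK⟩ := hsmooth.contDiffOn.exists_lipschitzOnWith one_ne_zero
    (convex_closedBall (0 : E2) 1) (isCompact_closedBall _ _)
  have hsub : Metric.ball (0 : Fin 3 → ℝ) (1 / 2) ⊆ P '' S3 := by
    intro a ha
    rw [mem_ball_zero_iff, pi_norm_lt_iff (by norm_num)] at ha
    have h0 : a 0 ^ 2 ≤ 1 / 4 := by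
      nlinarith [sq_abs (a 0), abs_nonneg (a 0), Real.norm_eq_abs (a 0), ha 0]
    have h1 : a 1 ^ 2 ≤ 1 / 4 := by
      nlinarith [sq_abs (a 1), abs_nonneg (a 1), Real.norm_eq_abs (a 1), ha 1]
    have h2 : a 2 ^ 2 ≤ 1 / 4 := by
      nlinarith [sq_abs (a 2), abs_nonneg (a 2), Real.norm_eq_abs (a 2), ha 2]
    refine ⟨!₂[⟨a 0, a 1⟩, ⟨a 2, √(1 - a 0 ^ 2 - a 1 ^ 2 - a 2 ^ 2)⟩], ?_, ?_⟩
    · rw [S3, mem_sphere_zero_iff_norm, ← sq_eq_sq₀ (norm_nonneg _) zero_le_one, norm_sq_E2,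
        ← Complex.normSq_eq_norm_sq, ← Complex.normSq_eq_norm_sq]
      simp only [Complex.normSq_apply, Matrix.cons_val_zero, Matrix.cons_val_one]
      rw [Real.mul_self_sqrt (by linarith)]
      ring
    · ext i
      fin_cases i <;> simp [hP]
  have hvol : μH[3] (Metric.ball (0 : Fin 3 → ℝ) (1 / 2)) ≠ 0 := by
    rw [hausdorffMeasure_fin_three]
    exact (Metric.measure_ball_pos _ _ (by norm_num)).ne'
  intro h
  rw [sigmaS3, Measure.restrict_apply_univ] at h
  refine hvol (le_antisymm ((measure_mono hsub).trans
    (((hK.mono Metric.sphere_subset_closedBall).hausdorffMeasure_image_le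
      (by norm_num)).trans ?_)) zero_le)
  change _ * μH[3] S3 ≤ 0
  rw [h, mul_zero]

/-- `ℂ × ℂ` as a copy of `ℂ²` with the Euclidean norm. -/
def prodEquivE2 : (ℂ × ℂ) ≃L[ℝ] E2 :=
  ((PiLp.continuousLinearEquiv 2 ℝ fun _ : Fin 2 => ℂ).trans
    (ContinuousLinearEquiv.finTwoArrow ℝ ℂ)).symm

instance : ((volume : Measure (ℂ × ℂ)).map prodEquivE2).IsAddHaarMeasure := by
  have : (volume : Measure (ℂ × ℂ)).IsAddHaarMeasure :=
    Measure.prod.instIsAddHaarMeasure volume volume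
  exact prodEquivE2.isAddHaarMeasure_map _

lemma measurable_prodEquivE2 : Measurable prodEquivE2 :=
  prodEquivE2.continuous.measurable

lemma setLIntegral_ball_normalize_map (F : E2 → ℝ≥0∞) (hF : Measurable F) :
    ∫⁻ x in Metric.ball 0 1, F (‖x‖⁻¹ • x) ∂((volume : Measure (ℂ × ℂ)).map prodEquivE2) =
      4⁻¹ * ∫⁻ u in Metric.ball (0 : ℂ) 1, circleFiber (F ∘ prodEquivE2) u := by
  have hnorm : ∀ x : ℂ × ℂ, ‖prodEquivE2 x‖ = √(‖x.1‖ ^ 2 + ‖x.2‖ ^ 2) := fun x => by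
    rw [← Real.sqrt_sq (norm_nonneg (prodEquivE2 x)), norm_sq_E2]
    rfl
  have hball : prodEquivE2 ⁻¹' Metric.ball 0 1 =
      {x : ℂ × ℂ | ‖x.1‖ ^ 2 + ‖x.2‖ ^ 2 < 1} := by
    ext x
    rw [Set.mem_preimage, mem_ball_zero_iff, hnorm, Real.sqrt_lt' one_pos, one_pow]
    rfl
  rw [← lintegral_ball_normalize_eq _ (hF.comp measurable_prodEquivE2),
    setLIntegral_map measurableSet_ball (by fun_prop) measurable_prodEquivE2, hball]
  refine lintegral_congr fun x => ?_
  rw [hnorm, Function.comp_apply, map_smul]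

lemma lintegral_comp_Psi (F : E2 → ℝ≥0∞) (hF : Measurable F) :
    ∫⁻ q, F (Psi q) ∂(volume : Measure (ℂ × ℝ)) =
      2 * ∫⁻ u in Metric.ball (0 : ℂ) 1, circleFiber
        ((fun ζ => F ζ * (ENNReal.ofReal ‖1 + ζ 1‖ ^ 4)⁻¹) ∘ prodEquivE2) u := by
  have hm := hF.comp measurable_prodEquivE2
  have hfiber : ∀ u, circleFiber
      ((fun ζ => F ζ * (ENNReal.ofReal ‖1 + ζ 1‖ ^ 4)⁻¹) ∘ prodEquivE2) u =
      (ENNReal.ofReal ‖1 + u‖ ^ 4)⁻¹ * circleFiber (F ∘ prodEquivE2) u := fun u => by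
    unfold circleFiber
    rw [← lintegral_const_mul _ (by fun_prop)]
    exact lintegral_congr fun φ => mul_comm _ _
  refine (lintegral_heisenberg_eq _ hm).trans ?_
  simp only [hfiber, mul_assoc]
  rw [lintegral_const_mul' _ _ (by simp), ← mul_assoc]
  congr 1
  rw [show (4 : ℝ≥0∞) = 2 * 2 by norm_num, ← mul_assoc,
    ENNReal.inv_mul_cancel (by simp) (by simp), one_mul]

lemma ENNReal.two_mul_eq_of_mul_eq {A B I J : ℝ≥0∞} (hB0 : B ≠ 0) (hBtop : B ≠ ⊤)
    (h : A * I = B * (4⁻¹ * J)) : 2 * J = 8 * A / B * I := by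
  rw [div_eq_mul_inv, mul_right_comm, mul_assoc 8 A I, h, mul_right_comm, mul_assoc 8,
    ← mul_assoc B⁻¹, ENNReal.inv_mul_cancel hB0 hBtop, one_mul, ← mul_assoc,
    show (8 : ℝ≥0∞) = 2 * 4 by norm_num, mul_assoc 2, ENNReal.mul_inv_cancel (by simp) (by simp),
    mul_one]

lemma measurable_mul_inv_norm_pow {F : E2 → ℝ≥0∞} (hF : Measurable F) :
    Measurable fun ζ : E2 => F ζ * (ENNReal.ofReal ‖1 + ζ 1‖ ^ 4)⁻¹ := by
  have hcoord : Measurable fun ζ : E2 => ζ 1 :=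
    (EuclideanSpace.proj (𝕜 := ℂ) (1 : Fin 2)).continuous.measurable
  exact hF.mul (((measurable_const.add hcoord).norm.ennreal_ofReal.pow_const 4).inv)

/-- Pushforward of Lebesgue measure under the Cayley map `Ψ`: there is `c > 0`
with `∫_{ℂ×ℝ} F(Ψ(z,t)) dλ = c ∫_{S³} F(ζ) |1+ζ₂|⁻⁴ dσ(ζ)` for every
measurable `F : ℂ² → [0,∞]`. -/
theorem pushforward_lebesgue :
    ∃ c : ℝ, 0 < c ∧ ∀ F : E2 → ℝ≥0∞, Measurable F →
      ∫⁻ q, F (Psi q) ∂(volume : Measure (ℂ × ℝ)) =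
        ENNReal.ofReal c *
          ∫⁻ ζ, F ζ * (ENNReal.ofReal ‖1 + ζ 1‖ ^ 4)⁻¹ ∂sigmaS3 := by
  set V : Measure E2 := (volume : Measure (ℂ × ℂ)).map prodEquivE2
  have hσfin : IsFiniteMeasure sigmaS3 := ⟨sigmaS3_univ_lt_top⟩
  have hA0 : V (Metric.ball 0 1) ≠ 0 := (Metric.measure_ball_pos V 0 one_pos).ne'
  have hAtop : V (Metric.ball 0 1) ≠ ⊤ := measure_ball_lt_top.ne
  have hB0 := sigmaS3_univ_ne_zero
  have hBtop := sigmaS3_univ_lt_top.ne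
  have hctop : 8 * V (Metric.ball 0 1) / sigmaS3 Set.univ ≠ ⊤ :=
    ENNReal.div_ne_top (ENNReal.mul_ne_top (by simp) hAtop) hB0
  refine ⟨(8 * V (Metric.ball 0 1) / sigmaS3 Set.univ).toReal,
    ENNReal.toReal_pos (ENNReal.div_ne_zero.2 ⟨mul_ne_zero (by simp) hA0, hBtop⟩) hctop, ?_⟩
  intro F hF
  have hw := measurable_mul_inv_norm_pow hF
  have h := addHaar_ball_mul_lintegral_sigmaS3 V _ hw
  rw [setLIntegral_ball_normalize_map _ hw] at h
  rw [lintegral_comp_Psi F hF, ENNReal.ofReal_toReal hctop]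
  exact ENNReal.two_mul_eq_of_mul_eq hB0 hBtop h
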